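/- arXiv:math/0601262 — 5 statements merged into one kernel-verified Lean document; each statement's English description precedes it below -/
import Mathlib

section
/- For every matrix 𝔖 ∈ SL(2,ℂ) there exists a unique real 4×4 matrix S (indexed by 0,1,2,3) such that 𝔖 · σ_m · 𝔖† = Σ_{k=0}^{3} S^k_m · σ_k for all m = 0,1,2,3; this matrix S satisfies Sᵀ g S = g, det S = 1 and S^0_0 > 0 (i.e. S lies in the special orthochronous Lorentz group SO⁺(1,3,ℝ)), and the resulting map φ: SL(2,ℂ) → SO⁺(1,3,ℝ), 𝔖 ↦ S, is a group homomorphism. -/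
open Matrix Complex

noncomputable section

/-- The Pauli matrices σ₀, σ₁, σ₂, σ₃. -/
def Pauli : Fin 4 → Matrix (Fin 2) (Fin 2) ℂ :=
  ![!![1, 0; 0, 1], !![0, 1; 1, 0], !![0, -I; I, 0], !![1, 0; 0, -1]]

/-- The tilde Pauli matrices: σ̃₀ = σ₀ and σ̃ₘ = -σₘ for m = 1,2,3. -/
def PauliT : Fin 4 → Matrix (Fin 2) (Fin 2) ℂ :=
  ![!![1, 0; 0, 1], -!![0, 1; 1, 0], -!![0, -I; I, 0], -!![1, 0; 0, -1]]

/-- The Dirac matrices γₘ = [[0, σₘ],[σ̃ₘ, 0]] in 2×2-block form, written out as 4×4 matrices. -/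
def Dirac : Fin 4 → Matrix (Fin 4) (Fin 4) ℂ :=
  ![!![0, 0, 1, 0; 0, 0, 0, 1; 1, 0, 0, 0; 0, 1, 0, 0],
    !![0, 0, 0, 1; 0, 0, 1, 0; 0, -1, 0, 0; -1, 0, 0, 0],
    !![0, 0, 0, -I; 0, 0, I, 0; 0, I, 0, 0; -I, 0, 0, 0],
    !![0, 0, 1, 0; 0, 0, 0, -1; -1, 0, 0, 0; 0, 1, 0, 0]]

/-- The Minkowski metric matrix g = diag(1,-1,-1,-1). -/
def etaMink : Matrix (Fin 4) (Fin 4) ℝ := !![1,0,0,0; 0,-1,0,0; 0,0,-1,0; 0,0,0,-1]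

/-- The defining relation of the homomorphism φ: 𝔖 σₘ 𝔖† = Σₖ Sᵏₘ σₖ. -/
def IsPhi (𝔖 : Matrix (Fin 2) (Fin 2) ℂ) (S : Matrix (Fin 4) (Fin 4) ℝ) : Prop :=
  ∀ m : Fin 4, 𝔖 * Pauli m * 𝔖ᴴ = ∑ k : Fin 4, (S k m : ℂ) • Pauli k

/-- The block-diagonal matrix Ŝ = diag(𝔖, (𝔖⁻¹)†). -/
def hatM (A : Matrix (Fin 2) (Fin 2) ℂ) : Matrix (Fin 4) (Fin 4) ℂ :=
  !![A 0 0, A 0 1, 0, 0;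
     A 1 0, A 1 1, 0, 0;
     0, 0, ((A⁻¹)ᴴ) 0 0, ((A⁻¹)ᴴ) 0 1;
     0, 0, ((A⁻¹)ᴴ) 1 0, ((A⁻¹)ᴴ) 1 1]

/-- The Pauli matrices are orthogonal for the trace form. -/
lemma trace_Pauli_mul_sum (k : Fin 4) (x : Fin 4 → ℝ) :
    (Pauli k * ∑ l, (x l : ℂ) • Pauli l).trace = 2 * x k := by
  fin_cases k <;>
    simp [Pauli, Fin.sum_univ_four, Matrix.trace_fin_two] <;>
    ring_nf <;> simp

lemma Pauli_isHermitian (m : Fin 4) : (Pauli m).IsHermitian := by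
  fin_cases m <;> ext i j <;> fin_cases i <;> fin_cases j <;> simp [Pauli]

/-- A Hermitian `2 × 2` matrix is a real combination of the Pauli matrices. -/
lemma Matrix.IsHermitian.eq_sum_Pauli {X : Matrix (Fin 2) (Fin 2) ℂ} (hX : X.IsHermitian) :
    X = ∑ k, (((Pauli k * X).trace.re / 2 : ℝ) : ℂ) • Pauli k := by
  have h00 := congrArg im (hX.apply 0 0)
  have h11 := congrArg im (hX.apply 1 1)
  have h01r := congrArg re (hX.apply 0 1)
  have h01i := congrArg im (hX.apply 0 1)
  simp only [star_def, conj_re, conj_im] at h00 h11 h01r h01i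
  ext i j
  fin_cases i <;> fin_cases j <;> apply Complex.ext <;>
    simp [Pauli, Fin.sum_univ_four, Matrix.trace_fin_two, Matrix.mul_apply] <;> linarith

lemma IsPhi.ext {A : Matrix (Fin 2) (Fin 2) ℂ} {S T : Matrix (Fin 4) (Fin 4) ℝ}
    (hS : IsPhi A S) (hT : IsPhi A T) : S = T := by
  ext k m
  have h := trace_Pauli_mul_sum k fun l => S l m
  rw [← hS m, hT m, trace_Pauli_mul_sum k fun l => T l m] at h
  exact_mod_cast (mul_left_cancel₀ two_ne_zero h).symm

lemma exists_isPhi (A : Matrix (Fin 2) (Fin 2) ℂ) : ∃ S, IsPhi A S :=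
  ⟨Matrix.of fun k m => (Pauli k * (A * Pauli m * Aᴴ)).trace.re / 2, fun m =>
    (isHermitian_mul_mul_conjTranspose A (Pauli_isHermitian m)).eq_sum_Pauli⟩

lemma IsPhi.mul {A B : Matrix (Fin 2) (Fin 2) ℂ} {S T : Matrix (Fin 4) (Fin 4) ℝ}
    (hS : IsPhi A S) (hT : IsPhi B T) : IsPhi (A * B) (S * T) := fun m => by
  calc A * B * Pauli m * (A * B)ᴴ = A * (B * Pauli m * Bᴴ) * Aᴴ := by
        simp only [conjTranspose_mul, Matrix.mul_assoc]
    _ = ∑ l, (T l m : ℂ) • ∑ k, (S k l : ℂ) • Pauli k := by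
        simp only [hT m, Matrix.mul_sum, Matrix.sum_mul, Matrix.mul_smul, Matrix.smul_mul, hS _]
    _ = ∑ k, ((S * T) k m : ℂ) • Pauli k := by
        simp only [Finset.smul_sum, smul_smul, Matrix.mul_apply, ofReal_sum, ofReal_mul,
          Finset.sum_smul]
        rw [Finset.sum_comm]
        simp only [mul_comm]

/-- The polarized determinant of real combinations of Pauli matrices is the Minkowski form. -/
lemma trace_sum_Pauli_mul_adjugate (x y : Fin 4 → ℝ) :
    ((∑ k, (x k : ℂ) • Pauli k) * adjugate (∑ k, (y k : ℂ) • Pauli k)).trace =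
      2 * ((x ⬝ᵥ etaMink *ᵥ y : ℝ) : ℂ) := by
  simp [Pauli, etaMink, Fin.sum_univ_four, Matrix.trace_fin_two,
    adjugate_fin_two, dotProduct, Matrix.mulVec]
  ring_nf
  simp
  ring

lemma trace_Pauli_mul_adjugate (m n : Fin 4) :
    (Pauli m * adjugate (Pauli n)).trace = 2 * (etaMink m n : ℂ) := by
  have h := trace_sum_Pauli_mul_adjugate (Pi.single m 1) (Pi.single n 1)
  simpa [Pi.single_apply] using h

lemma trace_conj_mul_adjugate_conj {A : Matrix (Fin 2) (Fin 2) ℂ} (hA : A.det = 1)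
    (X Y : Matrix (Fin 2) (Fin 2) ℂ) :
    ((A * X * Aᴴ) * adjugate (A * Y * Aᴴ)).trace = (X * adjugate Y).trace := by
  have h1 : adjugate A * A = 1 := by rw [adjugate_mul, hA, one_smul]
  have h2 : Aᴴ * adjugate Aᴴ = 1 := by
    rw [mul_adjugate, det_conjTranspose, hA, star_one, one_smul]
  calc ((A * X * Aᴴ) * adjugate (A * Y * Aᴴ)).trace
      = (A * (X * (Aᴴ * adjugate Aᴴ) * adjugate Y * adjugate A)).trace := by
        simp only [adjugate_mul_distrib, Matrix.mul_assoc]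
    _ = (X * adjugate Y * (adjugate A * A)).trace := by
        rw [trace_mul_comm, h2, Matrix.mul_one, Matrix.mul_assoc _ _ A]
    _ = (X * adjugate Y).trace := by rw [h1, Matrix.mul_one]

lemma IsPhi.transpose_mul_etaMink_mul {A : Matrix (Fin 2) (Fin 2) ℂ}
    {S : Matrix (Fin 4) (Fin 4) ℝ} (hS : IsPhi A S) (hA : A.det = 1) :
    Sᵀ * etaMink * S = etaMink := by
  ext m n
  have h := trace_conj_mul_adjugate_conj hA (Pauli m) (Pauli n)
  rw [hS m, hS n, trace_sum_Pauli_mul_adjugate (fun k => S k m) (fun k => S k n),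
    trace_Pauli_mul_adjugate] at h
  rw [Matrix.mul_assoc]
  exact_mod_cast mul_left_cancel₀ two_ne_zero h

/-- The change of basis from the Pauli matrices to the matrix units. -/
def pauliBasisMatrix : Matrix (Fin 2 × Fin 2) (Fin 4) ℂ := Matrix.of fun p k => Pauli k p.1 p.2

lemma conjTranspose_pauliBasisMatrix_mul_self :
    ((1 / 2 : ℂ) • pauliBasisMatrixᴴ) * pauliBasisMatrix = 1 := by
  ext k l
  fin_cases k <;> fin_cases l <;>
    simp [pauliBasisMatrix, Pauli, Matrix.mul_apply, Fintype.sum_prod_type] <;>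
    norm_num [mul_assoc]

open scoped Kronecker in
lemma IsPhi.kronecker_mul_pauliBasisMatrix {A : Matrix (Fin 2) (Fin 2) ℂ}
    {S : Matrix (Fin 4) (Fin 4) ℝ} (hS : IsPhi A S) :
    (A ⊗ₖ A.map (starRingEnd ℂ)) * pauliBasisMatrix = pauliBasisMatrix * S.map ofRealHom := by
  ext ⟨i, j⟩ m
  have h := congrFun (congrFun (hS m) i) j
  simp only [Matrix.mul_apply, Matrix.sum_apply, Matrix.smul_apply, conjTranspose_apply,
    Fin.sum_univ_two, smul_eq_mul, star_def] at h
  simp only [pauliBasisMatrix, Matrix.mul_apply, Fintype.sum_prod_type, kroneckerMap_apply,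
    Fin.sum_univ_two, of_apply, map_apply, ofRealHom_eq_coe, mul_comm (Pauli _ i j), ← h]
  ring

lemma IsPhi.det_eq_one {A : Matrix (Fin 2) (Fin 2) ℂ} {S : Matrix (Fin 4) (Fin 4) ℝ}
    (hS : IsPhi A S) (hA : A.det = 1) : S.det = 1 := by
  have hQP := conjTranspose_pauliBasisMatrix_mul_self
  have hPQ := (mul_eq_one_comm_of_card_eq _ _ _ (by simp)).1 hQP
  have h := det_conj_of_mul_eq_one (N := S.map ofRealHom) hPQ hQP
  rw [← hS.kronecker_mul_pauliBasisMatrix, Matrix.mul_assoc, hPQ, Matrix.mul_one, det_kronecker,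
    ← RingHom.mapMatrix_apply, ← RingHom.mapMatrix_apply, ← RingHom.map_det, ← RingHom.map_det,
    hA] at h
  simpa using h.symm

open scoped ComplexOrder in
lemma IsPhi.zero_zero_pos {A : Matrix (Fin 2) (Fin 2) ℂ} {S : Matrix (Fin 4) (Fin 4) ℝ}
    (hS : IsPhi A S) (hA : A ≠ 0) : 0 < S 0 0 := by
  have h := trace_Pauli_mul_sum 0 fun l => S l 0
  have h0 : Pauli 0 = 1 := one_fin_two.symm
  rw [← hS 0, h0, Matrix.one_mul, Matrix.mul_one] at h
  have hpos : 0 < (A * Aᴴ).trace :=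
    (posSemidef_self_mul_conjTranspose A).trace_nonneg.lt_of_ne'
      (trace_mul_conjTranspose_self_eq_zero_iff.not.2 hA)
  rw [h] at hpos
  have : (0 : ℝ) < 2 * S 0 0 := by exact_mod_cast hpos
  linarith

/-- For every 𝔖 ∈ SL(2,ℂ) there is a unique real 4×4 matrix S with
𝔖 σₘ 𝔖† = Σₖ Sᵏₘ σₖ; this S is a special orthochronous Lorentz matrix, and the
resulting map φ : SL(2,ℂ) → SO⁺(1,3,ℝ) is a group homomorphism. -/
theorem stmt0 :
    (∀ 𝔖 : Matrix.SpecialLinearGroup (Fin 2) ℂ,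
      ∃! S : Matrix (Fin 4) (Fin 4) ℝ, IsPhi (𝔖 : Matrix (Fin 2) (Fin 2) ℂ) S) ∧
    (∀ (𝔖 : Matrix.SpecialLinearGroup (Fin 2) ℂ) (S : Matrix (Fin 4) (Fin 4) ℝ),
      IsPhi (𝔖 : Matrix (Fin 2) (Fin 2) ℂ) S →
        Sᵀ * etaMink * S = etaMink ∧ S.det = 1 ∧ 0 < S 0 0) ∧
    (∀ (A B : Matrix.SpecialLinearGroup (Fin 2) ℂ)
        (SA SB SAB : Matrix (Fin 4) (Fin 4) ℝ),
      IsPhi (A : Matrix (Fin 2) (Fin 2) ℂ) SA →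
      IsPhi (B : Matrix (Fin 2) (Fin 2) ℂ) SB →
      IsPhi ((A * B : Matrix.SpecialLinearGroup (Fin 2) ℂ) : Matrix (Fin 2) (Fin 2) ℂ) SAB →
      SAB = SA * SB) := by
  refine ⟨fun A => ?_, fun A S hS => ?_, fun A B SA SB SAB hA hB hAB => ?_⟩
  · obtain ⟨S, hS⟩ := exists_isPhi (A : Matrix (Fin 2) (Fin 2) ℂ)
    exact ⟨S, hS, fun T hT => hT.ext hS⟩
  · have hA : (A : Matrix (Fin 2) (Fin 2) ℂ) ≠ 0 := fun h => by
      have hdet := A.det_coe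
      simp [h] at hdet
    exact ⟨hS.transpose_mul_etaMink_mul A.det_coe, hS.det_eq_one A.det_coe, hS.zero_zero_pos hA⟩
  · rw [Matrix.SpecialLinearGroup.coe_mul] at hAB
    exact hAB.ext (hA.mul hB)
end
end

section
/- Let 𝔖 ∈ SL(2,ℂ) and let S^k_m (k,m = 0,1,2,3) be complex coefficients such that 𝔖 · σ_m · 𝔖† = Σ_{k=0}^{3} S^k_m · σ_k for all m = 0,1,2,3. Then (𝔖⁻¹)† · σ̃_m · 𝔖⁻¹ = Σ_{k=0}^{3} S^k_m · σ̃_k for all m = 0,1,2,3. -/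
open Matrix Complex

noncomputable section

theorem adjugate_pauli (m : Fin 4) : (Pauli m).adjugate = PauliT m := by
  fin_cases m <;> simp [Pauli, PauliT, adjugate_fin_two]

/-- On `2 × 2` matrices the adjugate is linear. -/
theorem adjugate_sum_smul_fin_two {R ι : Type*} [CommRing R] (s : Finset ι) (c : ι → R)
    (A : ι → Matrix (Fin 2) (Fin 2) R) :
    (∑ k ∈ s, c k • A k).adjugate = ∑ k ∈ s, c k • (A k).adjugate := by
  ext i j
  fin_cases i <;> fin_cases j <;> simp [adjugate_fin_two, Matrix.sum_apply]

/-- If 𝔖 ∈ SL(2,ℂ) and 𝔖 σₘ 𝔖† = Σₖ Sᵏₘ σₖ, then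
(𝔖⁻¹)† σ̃ₘ 𝔖⁻¹ = Σₖ Sᵏₘ σ̃ₖ. -/
theorem stmt1 (𝔖 : Matrix (Fin 2) (Fin 2) ℂ) (hdet : 𝔖.det = 1)
    (S : Fin 4 → Fin 4 → ℂ)
    (hS : ∀ m : Fin 4, 𝔖 * Pauli m * 𝔖ᴴ = ∑ k : Fin 4, S k m • Pauli k) :
    ∀ m : Fin 4, (𝔖⁻¹)ᴴ * PauliT m * 𝔖⁻¹ = ∑ k : Fin 4, S k m • PauliT k := by
  intro m
  have hinv : 𝔖⁻¹ = 𝔖.adjugate := by simp [Matrix.inv_def, hdet]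
  have h := congrArg adjugate (hS m)
  simpa only [adjugate_mul_distrib, adjugate_sum_smul_fin_two, adjugate_pauli,
    ← adjugate_conjTranspose, ← hinv, ← Matrix.mul_assoc] using h
end
end

section
/- Let φ: SL(2,ℂ) → SO⁺(1,3,ℝ) be the homomorphism determined by 𝔖 · σ_m · 𝔖† = Σ_{k=0}^{3} φ(𝔖)^k_m · σ_k. If 𝔖, 𝔖' ∈ SL(2,ℂ) satisfy φ(𝔖') = P · φ(𝔖) · P, where P = diag(1,-1,-1,-1), then 𝔖' = (𝔖⁻¹)† or 𝔖' = -(𝔖⁻¹)†. In particular, the kernel of φ consists exactly of the two matrices I and -I. -/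
open Matrix Complex

noncomputable section

/-- The spatial inversion matrix P = diag(1,-1,-1,-1). -/
def Pmat : Matrix (Fin 4) (Fin 4) ℝ := !![1,0,0,0; 0,-1,0,0; 0,0,-1,0; 0,0,0,-1]

/-- The relation `IsPhi A 1` says that conjugation by `A` fixes every Pauli matrix. -/
theorem isPhi_one_iff (A : Matrix (Fin 2) (Fin 2) ℂ) :
    IsPhi A 1 ↔ ∀ m, A * Pauli m * Aᴴ = Pauli m := by
  refine forall_congr' fun m => ?_
  simp [Matrix.one_apply]

/-- A matrix of determinant one fixing the Pauli matrices under conjugation is `1` or `-1`. -/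
theorem eq_one_or_neg_one_of_isPhi_one {A : Matrix (Fin 2) (Fin 2) ℂ} (hA : A.det = 1)
    (h : IsPhi A 1) : A = 1 ∨ A = -1 := by
  rw [isPhi_one_iff] at h
  have h0 : A * Aᴴ = 1 := by
    simpa [Pauli, ← Matrix.one_fin_two] using h 0
  have hadj : Aᴴ = A.adjugate := by
    rw [← Matrix.inv_eq_right_inv h0, Matrix.inv_def, hA]
    simp
  have h1 := h 1
  have h3 := h 3
  rw [hadj, Matrix.adjugate_fin_two] at h1 h3
  obtain ⟨a, b, c, d, rfl⟩ : ∃ a b c d, A = !![a, b; c, d] :=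
    ⟨_, _, _, _, Matrix.eta_fin_two A⟩
  rw [Matrix.det_fin_two_of] at hA
  have e1 := congrFun (congrFun h1 0) 1
  have e2 := congrFun (congrFun h3 0) 0
  have e3 := congrFun (congrFun h3 0) 1
  have e4 := congrFun (congrFun h3 1) 0
  simp [Pauli, Matrix.mul_apply, Fin.sum_univ_two] at e1 e2 e3 e4
  have had : a * d = 1 := by linear_combination (e2 + hA) / 2
  have hb : b = 0 := by linear_combination (-b) * had - d * e3 / 2
  have hc : c = 0 := by linear_combination (-c) * had + a * e4 / 2
  subst hb hc
  have ha : a * a = 1 := by linear_combination e1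
  rcases mul_self_eq_one_iff.mp ha with rfl | rfl
  · left
    have hd : d = 1 := by linear_combination had
    simp [hd, Matrix.one_fin_two]
  · right
    have hd : d = -1 := by linear_combination -had
    simp [hd, Matrix.one_fin_two]

/-- Two matrices of determinant one inducing the same Lorentz matrix agree up to sign. -/
theorem IsPhi.eq_or_eq_neg {A B : Matrix (Fin 2) (Fin 2) ℂ} {S : Matrix (Fin 4) (Fin 4) ℝ}
    (hA : A.det = 1) (hB : B.det = 1) (hAS : IsPhi A S) (hBS : IsPhi B S) :
    A = B ∨ A = -B := by
  have hu : IsUnit B.det := by simp [hB]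
  have hdet : (B⁻¹ * A).det = 1 := by
    simp [Matrix.det_mul, Matrix.det_nonsing_inv, hA, hB]
  have hphi : IsPhi (B⁻¹ * A) 1 := by
    rw [isPhi_one_iff]
    intro m
    calc B⁻¹ * A * Pauli m * (B⁻¹ * A)ᴴ
        = B⁻¹ * (A * Pauli m * Aᴴ) * B⁻¹ᴴ := by
          simp only [Matrix.conjTranspose_mul, Matrix.mul_assoc]
      _ = B⁻¹ * (B * Pauli m * Bᴴ) * B⁻¹ᴴ := by rw [hAS m, hBS m]
      _ = B⁻¹ * B * Pauli m * (B⁻¹ * B)ᴴ := by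
          simp only [Matrix.conjTranspose_mul, Matrix.mul_assoc]
      _ = Pauli m := by simp [Matrix.nonsing_inv_mul B hu]
  have hmul : A = B * (B⁻¹ * A) := (Matrix.mul_nonsing_inv_cancel_left B A hu).symm
  rcases eq_one_or_neg_one_of_isPhi_one hdet hphi with h | h
  · left; rw [hmul, h, mul_one]
  · right; rw [hmul, h, mul_neg, mul_one]

/-- The spatial inversion as a diagonal matrix. -/
theorem Pmat_eq_diagonal : Pmat = Matrix.diagonal ![1, -1, -1, -1] := by
  ext i j
  fin_cases i <;> fin_cases j <;> simp [Pmat]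

set_option maxHeartbeats 1000000 in
/-- The contragredient matrix `(A⁻¹)ᴴ` induces the spatially inverted Lorentz matrix. -/
theorem IsPhi.inv_conjTranspose {A : Matrix (Fin 2) (Fin 2) ℂ} {S : Matrix (Fin 4) (Fin 4) ℝ}
    (hA : A.det = 1) (h : IsPhi A S) : IsPhi (A⁻¹)ᴴ (Pmat * S * Pmat) := by
  have hinv : A⁻¹ = A.adjugate := by simp [Matrix.inv_def, hA]
  rw [hinv, Matrix.adjugate_fin_two, Pmat_eq_diagonal]
  intro m
  have hm := h m
  have e00 := congrFun (congrFun hm 0) 0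
  have e01 := congrFun (congrFun hm 0) 1
  have e10 := congrFun (congrFun hm 1) 0
  have e11 := congrFun (congrFun hm 1) 1
  obtain rfl | hm0 := eq_or_ne m 0
  · ext i j
    fin_cases i <;> fin_cases j <;>
      simp [Pauli, Matrix.mul_diagonal, Matrix.diagonal_mul, Fin.sum_univ_four,
          Fin.sum_univ_two, Matrix.mul_apply (m := Fin 2)]
        at e00 e01 e10 e11 ⊢
    · linear_combination e11
    · linear_combination -e01
    · linear_combination -e10
    · linear_combination e00
  · ext i j
    fin_cases m <;> [exact absurd rfl hm0; skip; skip; skip] <;> fin_cases i <;> fin_cases j <;>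
      simp [Pauli, Matrix.mul_diagonal, Matrix.diagonal_mul, Fin.sum_univ_four,
          Fin.sum_univ_two, Matrix.mul_apply (m := Fin 2)]
        at e00 e01 e10 e11 ⊢ <;>
      first
      | linear_combination -e11
      | linear_combination e01
      | linear_combination e10
      | linear_combination -e00

/-- If φ(𝔖') = P·φ(𝔖)·P then 𝔖' = ±(𝔖⁻¹)†; and the kernel of φ is {I, -I}. -/
theorem stmt3 :
    (∀ 𝔖 𝔖' : Matrix (Fin 2) (Fin 2) ℂ, 𝔖.det = 1 → 𝔖'.det = 1 →
      ∀ S S' : Matrix (Fin 4) (Fin 4) ℝ, IsPhi 𝔖 S → IsPhi 𝔖' S' →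
        S' = Pmat * S * Pmat →
        𝔖' = (𝔖⁻¹)ᴴ ∨ 𝔖' = -(𝔖⁻¹)ᴴ) ∧
    (∀ 𝔖 : Matrix (Fin 2) (Fin 2) ℂ, 𝔖.det = 1 →
      (IsPhi 𝔖 1 ↔ 𝔖 = 1 ∨ 𝔖 = -1)) := by
  refine ⟨fun A B hA hB S S' hS hS' hSS' => ?_, fun A hA =>
    ⟨eq_one_or_neg_one_of_isPhi_one hA, ?_⟩⟩
  · subst hSS'
    refine IsPhi.eq_or_eq_neg hB ?_ hS' (hS.inv_conjTranspose hA)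
    simp [Matrix.det_conjTranspose, Matrix.det_nonsing_inv, hA]
  · rw [isPhi_one_iff]
    rintro (rfl | rfl) m <;> simp
end
end

section
/- A 4×4 complex matrix X satisfies the four equations X·γ₀ = γ₀·X, X·γ₁ = -γ₁·X, X·γ₂ = -γ₂·X, X·γ₃ = -γ₃·X if and only if X = C·γ₀ for some complex number C. -/
open Matrix Complex

noncomputable section

/-- X commutes with γ₀ and anticommutes with γ₁, γ₂, γ₃ iff X = C·γ₀. -/
theorem stmt8 (X : Matrix (Fin 4) (Fin 4) ℂ) :
    (X * Dirac 0 = Dirac 0 * X ∧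
     X * Dirac 1 = -(Dirac 1 * X) ∧
     X * Dirac 2 = -(Dirac 2 * X) ∧
     X * Dirac 3 = -(Dirac 3 * X)) ↔
    ∃ C : ℂ, X = C • Dirac 0 := by
  constructor
  · rintro ⟨h0, h1, h2, h3⟩
    refine ⟨X 0 2, ?_⟩
    have hI : I * I = -1 := I_mul_I
    simp only [← Matrix.ext_iff, Fin.forall_fin_succ, Matrix.mul_apply, Fin.sum_univ_four,
      Matrix.neg_apply] at h0 h1 h2 h3
    simp [Dirac] at h0 h1 h2 h3
    ext i j
    fin_cases i <;> fin_cases j <;> simp [Dirac] <;> grind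
  · rintro ⟨C, rfl⟩
    refine ⟨by simp, ?_, ?_, ?_⟩ <;> ext i j <;> fin_cases i <;> fin_cases j <;>
      simp [Dirac, Matrix.mul_apply, Fin.sum_univ_four, mul_comm]
end
end

section
/- A 4×4 complex matrix Y satisfies the four equations Y·γ₀ = -γ₀·Y, Y·γ₁ = γ₁·Y, Y·γ₂ = γ₂·Y, Y·γ₃ = γ₃·Y if and only if Y = C·γ₁·γ₂·γ₃ for some complex number C. -/
open Matrix Complex

noncomputable section

/-- The product γ₁γ₂γ₃ is the block matrix with off-diagonal blocks ∓i. -/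
theorem Dirac_one_mul_two_mul_three :
    Dirac 1 * Dirac 2 * Dirac 3 =
      !![0, 0, -I, 0; 0, 0, 0, -I; I, 0, 0, 0; 0, I, 0, 0] := by
  ext i j
  fin_cases i <;> fin_cases j <;> simp [Dirac, Matrix.mul_apply, Fin.sum_univ_four]

/-- Y anticommutes with γ₀ and commutes with γ₁, γ₂, γ₃ iff Y = C·γ₁γ₂γ₃. -/
theorem stmt9 (Y : Matrix (Fin 4) (Fin 4) ℂ) :
    (Y * Dirac 0 = -(Dirac 0 * Y) ∧
     Y * Dirac 1 = Dirac 1 * Y ∧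
     Y * Dirac 2 = Dirac 2 * Y ∧
     Y * Dirac 3 = Dirac 3 * Y) ↔
    ∃ C : ℂ, Y = C • (Dirac 1 * Dirac 2 * Dirac 3) := by
  rw [Dirac_one_mul_two_mul_three]
  constructor
  · rintro ⟨h0, h1, h2, h3⟩
    refine ⟨I * Y 0 2, ?_⟩
    simp only [← Matrix.ext_iff, Fin.forall_fin_succ, Dirac, Matrix.neg_apply, Matrix.mul_apply,
      Fin.sum_univ_four] at h0 h1 h2 h3
    simp at h0 h1 h2 h3
    ext i j
    fin_cases i <;> fin_cases j <;> simp <;> grind [I_mul_I, I_ne_zero]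
  · rintro ⟨C, rfl⟩
    refine ⟨?_, ?_, ?_, ?_⟩ <;> ext i j <;> fin_cases i <;> fin_cases j <;>
      simp [Dirac, Matrix.mul_apply, Fin.sum_univ_four] <;>
      ring
end
end
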